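/- Let A ∈ ℂ^{N×N} with Schur decomposition Q*AQ = D + U, where Q is unitary, D diagonal, and U strictly upper triangular. If f is analytic on a closed convex set Ω containing the spectrum of A, then ‖f(A)‖ ≤ Σ_{i=0}^{N−1} sup_{z∈Ω} |f^{(i)}(z)| · ‖U‖_F^i / i!, where ‖·‖_F is the Frobenius norm. -/

import Mathlib

open Matrix

/-- Operator 2-norm (spectral norm) of a complex matrix. -/
noncomputable def opNorm2 {n : ℕ} (A : Matrix (Fin n) (Fin n) ℂ) : ℝ :=
  ‖Matrix.toEuclideanCLM (𝕜 := ℂ) A‖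

/-- Frobenius norm of a complex matrix. -/
noncomputable def frobNorm {n : ℕ} (U : Matrix (Fin n) (Fin n) ℂ) : ℝ :=
  Real.sqrt (∑ i, ∑ j, ‖U i j‖ ^ 2)


lemma aux_diff_iter {V : Set ℂ} (hV : IsOpen V) {g : ℂ → ℂ} (hg : DifferentiableOn ℂ g V)
    (j : ℕ) : DifferentiableOn ℂ (iteratedDeriv j g) V := by
  induction j with
  | zero => simpa using hg
  | succ j ih => rw [iteratedDeriv_succ]; exact ih.deriv hV

lemma aux_identity {V : Set ℂ} (hV : IsOpen V) {f g : ℂ → ℂ} (hg : DifferentiableOn ℂ g V)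
    (a c : ℂ) (h : ∀ w ∈ V, f w = c + (w - a) * g w) (j : ℕ) :
    ∀ w ∈ V, iteratedDeriv (j + 1) f w
      = (j + 1) * iteratedDeriv j g w + (w - a) * iteratedDeriv (j + 1) g w := by
  induction j with
  | zero =>
    intro w hw
    have h1 : f =ᶠ[nhds w] fun w => c + (w - a) * g w :=
      Filter.eventuallyEq_of_mem (hV.mem_nhds hw) h
    have hgd := (hg.differentiableAt (hV.mem_nhds hw)).hasDerivAt
    have h2 : HasDerivAt (fun w => c + (w - a) * g w) (1 * g w + (w - a) * deriv g w) w :=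
      (((hasDerivAt_id w).sub_const a).mul hgd).const_add c
    simp only [zero_add, iteratedDeriv_one, iteratedDeriv_zero, h1.deriv_eq, h2.deriv]
    simp
  | succ j ih =>
    intro w hw
    have h1 : iteratedDeriv (j + 1) f =ᶠ[nhds w] fun w =>
        (j + 1) * iteratedDeriv j g w + (w - a) * iteratedDeriv (j + 1) g w :=
      Filter.eventuallyEq_of_mem (hV.mem_nhds hw) ih
    have hg0 := ((aux_diff_iter hV hg j).differentiableAt (hV.mem_nhds hw)).hasDerivAt
    have hg1 := ((aux_diff_iter hV hg (j + 1)).differentiableAt (hV.mem_nhds hw)).hasDerivAt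
    have h2 := (hg0.const_mul ((j : ℂ) + 1)).add (((hasDerivAt_id w).sub_const a).mul hg1)
    have h3 := h1.deriv_eq.trans h2.deriv
    rw [iteratedDeriv_succ, h3, ← iteratedDeriv_succ, ← iteratedDeriv_succ]
    simp only [id]
    push_cast
    ring

lemma aux_bound {V Ω : Set ℂ} (hV : IsOpen V) (hΩV : Ω ⊆ V) (hΩ : Convex ℝ Ω)
    {f g : ℂ → ℂ} (hg : DifferentiableOn ℂ g V)
    (a c : ℂ) (ha : a ∈ Ω) (h : ∀ w ∈ V, f w = c + (w - a) * g w) (j : ℕ) (C : ℝ)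
    (hC : ∀ w ∈ Ω, ‖iteratedDeriv (j + 1) f w‖ ≤ C) :
    ∀ w ∈ Ω, ‖iteratedDeriv j g w‖ ≤ C / (j + 1) := by
  intro z hz
  have hmem : ∀ t ∈ Set.Icc (0 : ℝ) 1, a + (t : ℂ) * (z - a) ∈ Ω := by
    intro t ht
    have := hΩ.add_smul_sub_mem ha hz ht
    simpa using this
  set F : ℝ → ℂ := fun t => ((t : ℂ)) ^ (j + 1) * iteratedDeriv j g (a + (t : ℂ) * (z - a))
  have hF : ∀ t ∈ Set.Icc (0 : ℝ) 1,
      HasDerivAt F ((t : ℂ) ^ j * iteratedDeriv (j + 1) f (a + (t : ℂ) * (z - a))) t := by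
    intro t ht
    have hw := hΩV (hmem t ht)
    have hg0 := ((aux_diff_iter hV hg j).differentiableAt (hV.mem_nhds hw)).hasDerivAt
    have hl : HasDerivAt (fun s : ℂ => a + s * (z - a)) (1 * (z - a)) (t : ℂ) :=
      ((hasDerivAt_id (t : ℂ)).mul_const (z - a)).const_add a
    have h1 := (hasDerivAt_pow (j + 1) (t : ℂ)).mul
      (HasDerivAt.comp (t : ℂ) (h₂ := iteratedDeriv j g) hg0 hl)
    have h2 : HasDerivAt F _ t := h1.comp_ofReal
    refine h2.congr_deriv ?_
    rw [aux_identity hV hg a c h j _ hw, ← iteratedDeriv_succ]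
    simp only [Function.comp]
    rw [Nat.add_sub_cancel]
    push_cast
    ring
  have key := image_norm_le_of_norm_deriv_right_le_deriv_boundary (f := F) (a := 0) (b := 1)
    (f' := fun t => (t : ℂ) ^ j * iteratedDeriv (j + 1) f (a + (t : ℂ) * (z - a)))
    (B := fun t => C / (j + 1) * t ^ (j + 1)) (B' := fun t => t ^ j * C)
    (fun t ht => (hF t ht).continuousAt.continuousWithinAt)
    (fun t ht => (hF t ⟨ht.1, ht.2.le⟩).hasDerivWithinAt)
    (by simp [F])
    (by
      intro x
      have := (hasDerivAt_pow (j + 1) x).const_mul (C / (j + 1))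
      refine this.congr_deriv ?_
      rw [Nat.add_sub_cancel]
      push_cast
      field_simp)
    (by
      intro t ht
      rw [norm_mul, norm_pow, Complex.norm_real, Real.norm_of_nonneg ht.1]
      exact mul_le_mul_of_nonneg_left (hC _ (hmem t ⟨ht.1, ht.2.le⟩)) (pow_nonneg ht.1 _))
    (x := 1) (by simp)
  simpa [F] using key

lemma aux_interp {ι : Type*} {V : Set ℂ} (hV : IsOpen V) (lam : ι → ℂ)
    (hlam : ∀ i, lam i ∈ V) (f : ℂ → ℂ) (hf : DifferentiableOn ℂ f V) (s : Finset ι) :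
    ∃ (q : Polynomial ℂ) (h : ℂ → ℂ), DifferentiableOn ℂ h V ∧
      ∀ z, f z = q.eval z + h z * ∏ i ∈ s, (z - lam i) := by
  classical
  induction s using Finset.induction_on with
  | empty => exact ⟨0, f, hf, by simp⟩
  | insert b s hb ih =>
    obtain ⟨q, h, hh, e⟩ := ih
    refine ⟨q + Polynomial.C (h (lam b)) * ∏ i ∈ s, (Polynomial.X - Polynomial.C (lam i)),
      dslope h (lam b),
      (Complex.differentiableOn_dslope (hV.mem_nhds (hlam b))).2 hh, fun z => ?_⟩
    have := sub_smul_dslope h (lam b) z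
    rw [smul_eq_mul] at this
    rw [e z, Finset.prod_insert hb]
    simp only [Polynomial.eval_add, Polynomial.eval_mul, Polynomial.eval_C, Polynomial.eval_prod,
      Polynomial.eval_sub, Polynomial.eval_X]
    linear_combination (-∏ i ∈ s, (z - lam i)) * this

lemma aux_pow_nonneg {N : ℕ} (U : Matrix (Fin N) (Fin N) ℂ) (k : ℕ) :
    ∀ i j : Fin N, 0 ≤ ((U.map norm) ^ k) i j := by
  induction k with
  | zero => intro i j; rw [pow_zero, Matrix.one_apply]; split_ifs <;> norm_num
  | succ k ihk =>
    intro i j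
    rw [pow_succ, Matrix.mul_apply]
    exact Finset.sum_nonneg fun l _ => mul_nonneg (ihk _ _) (norm_nonneg (U l j))

lemma aux_row {N : ℕ} {V Ω : Set ℂ} (hV : IsOpen V) (hΩV : Ω ⊆ V) (hΩ : Convex ℝ Ω)
    (lam : Fin N → ℂ) (hlam : ∀ i, lam i ∈ Ω) (U : Matrix (Fin N) (Fin N) ℂ)
    (hU : ∀ i j : Fin N, j ≤ i → U i j = 0) (r : Fin N) :
    ∀ (f : ℂ → ℂ) (M : ℕ → ℝ) (p : Polynomial ℂ) (h : ℂ → ℂ), DifferentiableOn ℂ f V →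
      DifferentiableOn ℂ h V →
      (∀ i : ℕ, ∀ w ∈ Ω, ‖iteratedDeriv i f w‖ ≤ M i) →
      (∀ z ∈ V, f z = p.eval z + h z * ∏ i ∈ Finset.Ici r, (z - lam i)) →
      ∀ j, ‖(Polynomial.aeval (diagonal lam + U) p) r j‖ ≤
        ∑ k ∈ Finset.range (N - r), M k / (k.factorial : ℝ) * ((U.map norm) ^ k) r j := by
  induction hn : N - (r : ℕ) using Nat.strong_induction_on generalizing r with
  | _ n ih =>
  subst hn
  intro f M p h hf hh hM hfp j
  set B : Matrix (Fin N) (Fin N) ℝ := U.map norm with hB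
  have hBk : ∀ k (i j : Fin N), 0 ≤ (B ^ k) i j := by
    exact aux_pow_nonneg U
  have hM0 : ∀ k, 0 ≤ M k := fun k => (norm_nonneg _).trans (hM k _ (hlam r))
  set T := diagonal lam + U with hT
  set p1 := p /ₘ (Polynomial.X - Polynomial.C (lam r)) with hp1
  have hp : p = Polynomial.C (p.eval (lam r)) +
      (Polynomial.X - Polynomial.C (lam r)) * p1 := by
    have := Polynomial.modByMonic_add_div p (Polynomial.X - Polynomial.C (lam r))
    rw [Polynomial.modByMonic_X_sub_C_eq_C_eval] at this
    exact this.symm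
  have hfr : f (lam r) = p.eval (lam r) := by
    rw [hfp _ (hΩV (hlam r)), Finset.prod_eq_zero (i := r) (by simp) (by simp)]
    simp
  -- the divided difference
  set f1 : ℂ → ℂ := fun z => p1.eval z + h z * ∏ i ∈ Finset.Ioi r, (z - lam i) with hf1
  have hf1d : DifferentiableOn ℂ f1 V := by
    apply DifferentiableOn.add
    · exact p1.differentiable.differentiableOn
    · apply hh.mul
      apply Differentiable.differentiableOn
      fun_prop
  have hff1 : ∀ w ∈ V, f w = p.eval (lam r) + (w - lam r) * f1 w := by
    intro w hw
    have hIci : Finset.Ici r = insert r (Finset.Ioi r) := by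
      ext x; simp [le_iff_eq_or_lt, eq_comm]
    rw [hfp w hw, hIci, Finset.prod_insert (by simp)]
    have : p.eval w = p.eval (lam r) + (w - lam r) * p1.eval w := by
      conv_lhs => rw [hp]
      simp
    rw [this, hf1]
    ring
  have hM1 : ∀ i : ℕ, ∀ w ∈ Ω, ‖iteratedDeriv i f1 w‖ ≤ M (i + 1) / (i + 1) := fun i =>
    aux_bound hV hΩV hΩ hf1d _ _ (hlam r) hff1 i _ (hM (i + 1))
  have hrow : (Polynomial.aeval T p) r j = p.eval (lam r) * (1 : Matrix (Fin N) (Fin N) ℂ) r j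
      + ∑ l, U r l * (Polynomial.aeval T p1) l j := by
    conv_lhs => rw [hp]
    have e : Polynomial.aeval T (Polynomial.C (p.eval (lam r)) +
      (Polynomial.X - Polynomial.C (lam r)) * p1) = p.eval (lam r) • 1 +
        (T - lam r • 1) * Polynomial.aeval T p1 := by
      simp [Algebra.algebraMap_eq_smul_one]
    rw [e, Matrix.add_apply, Matrix.smul_apply, smul_eq_mul, Matrix.mul_apply]
    congr 1
    apply Finset.sum_congr rfl
    intro l _
    congr 1
    simp only [hT, Matrix.sub_apply, Matrix.add_apply, Matrix.smul_apply, Matrix.diagonal_apply,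
      Matrix.one_apply]
    split_ifs <;> simp
  obtain ⟨n, hn⟩ : ∃ n, N - (r : ℕ) = n + 1 := ⟨N - r - 1, by have := r.2; omega⟩
  have hl : ∀ l, ‖U r l * (Polynomial.aeval T p1) l j‖ ≤
      ∑ k ∈ Finset.range n, M (k + 1) / ((k + 1).factorial : ℝ) * (B r l * (B ^ k) l j) := by
    intro l
    by_cases hlr : l ≤ r
    · rw [hU r l hlr, zero_mul, norm_zero]
      refine Finset.sum_nonneg fun k _ => ?_
      exact mul_nonneg (div_nonneg (hM0 _) (Nat.cast_nonneg _))
        (mul_nonneg (norm_nonneg (U r l)) (hBk _ _ _))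
    · push Not at hlr
      have hlr' : (r : ℕ) < l := hlr
      have hIoi : Finset.Ici l ⊆ Finset.Ioi r := by
        intro x hx
        simp only [Finset.mem_Ici, Finset.mem_Ioi] at *
        exact hlr.trans_le hx
      have := ih (N - l) (by have := l.2; omega) l rfl f1 (fun i => M (i + 1) / (i + 1)) p1
        (fun z => h z * ∏ i ∈ Finset.Ioi r \ Finset.Ici l, (z - lam i)) hf1d
        (hh.mul (Differentiable.differentiableOn (by fun_prop))) hM1
        (by
          intro z _
          rw [mul_assoc, Finset.prod_sdiff hIoi]) j
      rw [norm_mul]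
      calc ‖U r l‖ * ‖(Polynomial.aeval T p1) l j‖
          ≤ B r l * ∑ k ∈ Finset.range (N - l),
            M (k + 1) / (k + 1) / (k.factorial : ℝ) * (B ^ k) l j :=
            mul_le_mul_of_nonneg_left this (norm_nonneg _)
        _ ≤ B r l * ∑ k ∈ Finset.range n,
            M (k + 1) / (k + 1) / (k.factorial : ℝ) * (B ^ k) l j := by
            refine mul_le_mul_of_nonneg_left ?_ (norm_nonneg (U r l))
            refine Finset.sum_le_sum_of_subset_of_nonneg ?_ ?_
            · apply Finset.range_mono; omega
            · intro k _ _
              have := hM0 (k + 1)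
              have := hBk k l j
              positivity
        _ = _ := by
            rw [Finset.mul_sum]
            refine Finset.sum_congr rfl fun k _ => ?_
            rw [Nat.factorial_succ]
            push_cast
            field_simp
  rw [hrow, hn, Finset.sum_range_succ']
  refine (norm_add_le _ _).trans ?_
  rw [add_comm]
  refine add_le_add ?_ ?_
  · refine (norm_sum_le _ _).trans ((Finset.sum_le_sum fun l _ => hl l).trans ?_)
    rw [Finset.sum_comm]
    refine Finset.sum_le_sum fun k _ => ?_
    rw [← Finset.mul_sum, pow_succ', Matrix.mul_apply]
  · rw [norm_mul, ← hfr]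
    have h0 := hM 0 _ (hlam r)
    rw [iteratedDeriv_zero] at h0
    simp only [Nat.factorial_zero, Nat.cast_one, div_one, pow_zero, Matrix.one_apply]
    split_ifs
    · simpa using h0
    · simp

lemma aux_poly_iter (p : Polynomial ℂ) (j : ℕ) :
    iteratedDeriv j (fun w => p.eval w) = fun w => (Polynomial.derivative^[j] p).eval w := by
  induction j generalizing p with
  | zero => simp
  | succ j ih =>
    rw [iteratedDeriv_succ', Function.iterate_succ_apply, ← ih]
    congr 1
    funext w
    exact p.deriv

lemma aux_dvd (m p : Polynomial ℂ) (hm : m ≠ 0)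
    (h : ∀ μ : ℂ, ∀ j < m.rootMultiplicity μ, iteratedDeriv j (fun w => p.eval w) μ = 0) :
    m ∣ p := by
  by_cases hp : p = 0
  · simp [hp]
  rw [IsAlgClosed.dvd_iff_roots_le_roots hm hp, Multiset.le_iff_count]
  intro μ
  rw [Polynomial.count_roots, Polynomial.count_roots]
  by_contra hlt
  push Not at hlt
  refine absurd ((Polynomial.lt_rootMultiplicity_iff_isRoot_iterate_derivative (t := μ)
    (n := p.rootMultiplicity μ) hp).2 ?_) (lt_irrefl _)
  intro k hk
  have := h μ k (by omega)
  rw [aux_poly_iter] at this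
  exact this

lemma aux_vanish {V : Set ℂ} (hV : IsOpen V) (h : ℂ → ℂ) (hh : DifferentiableOn ℂ h V)
    (P : Polynomial ℂ) (hP : P ≠ 0) (μ : ℂ) (hμ : μ ∈ V) (j : ℕ)
    (hj : j < P.rootMultiplicity μ) :
    iteratedDeriv j (fun z => h z * P.eval z) μ = 0 := by
  have hha : AnalyticAt ℂ h μ := hh.analyticAt (hV.mem_nhds hμ)
  have hPa : AnalyticAt ℂ (fun z => P.eval z) μ := by
    exact (P.differentiable.differentiableOn (s := Set.univ)).analyticAt Filter.univ_mem
  obtain ⟨R, hR⟩ := Polynomial.pow_rootMultiplicity_dvd P μ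
  have hRa : AnalyticAt ℂ (fun z => R.eval z) μ := by
    exact (R.differentiable.differentiableOn (s := Set.univ)).analyticAt Filter.univ_mem
  refine (natCast_le_analyticOrderAt_iff_iteratedDeriv_eq_zero (hha.fun_mul hPa)).1 ?_ j hj
  rw [natCast_le_analyticOrderAt (hha.fun_mul hPa)]
  refine ⟨fun z => h z * R.eval z, hha.fun_mul hRa, Filter.Eventually.of_forall fun z => ?_⟩
  conv_lhs => rw [hR]
  simp
  ring

lemma aux_norm_le {N : ℕ} (X : Matrix (Fin N) (Fin N) ℂ) (C : Matrix (Fin N) (Fin N) ℝ)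
    (h : ∀ i j, ‖X i j‖ ≤ C i j) :
    opNorm2 X ≤ ‖Matrix.toEuclideanCLM (𝕜 := ℝ) C‖ := by
  refine ContinuousLinearMap.opNorm_le_bound _ (norm_nonneg _) fun v => ?_
  set w : EuclideanSpace ℝ (Fin N) := WithLp.toLp 2 fun i => ‖v i‖
  have hw : ‖w‖ = ‖v‖ := by
    simp [EuclideanSpace.norm_eq, w]
  rw [← hw]
  refine le_trans ?_ ((Matrix.toEuclideanCLM (𝕜 := ℝ) C).le_opNorm w)
  rw [EuclideanSpace.norm_eq, EuclideanSpace.norm_eq]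
  apply Real.sqrt_le_sqrt
  refine Finset.sum_le_sum fun i _ => ?_
  refine pow_le_pow_left₀ (norm_nonneg _) ?_ 2
  have e1 : (Matrix.toEuclideanCLM (𝕜 := ℂ) X v) i = ∑ j, X i j * v j := by
    simp [Matrix.mulVec, dotProduct]
  have e2 : (Matrix.toEuclideanCLM (𝕜 := ℝ) C w) i = ∑ j, C i j * ‖v j‖ := by
    simp [Matrix.mulVec, dotProduct, w]
  rw [e1, e2]
  refine (norm_sum_le _ _).trans (le_trans ?_ (le_abs_self _))
  refine Finset.sum_le_sum fun j _ => ?_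
  rw [norm_mul]
  exact mul_le_mul_of_nonneg_right (h i j) (norm_nonneg _)

lemma aux_frob {N : ℕ} (U : Matrix (Fin N) (Fin N) ℂ) :
    ‖Matrix.toEuclideanCLM (𝕜 := ℝ) (U.map norm)‖ ≤ frobNorm U := by
  refine ContinuousLinearMap.opNorm_le_bound _ (Real.sqrt_nonneg _) fun v => ?_
  rw [EuclideanSpace.norm_eq, EuclideanSpace.norm_eq, frobNorm, ← Real.sqrt_mul (by positivity)]
  apply Real.sqrt_le_sqrt
  rw [Finset.sum_mul]
  refine Finset.sum_le_sum fun i _ => ?_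
  have e2 : (Matrix.toEuclideanCLM (𝕜 := ℝ) (U.map norm) v) i = ∑ j, ‖U i j‖ * v j := by
    simp [Matrix.mulVec, dotProduct]
  rw [e2, Real.norm_eq_abs, sq_abs]
  simpa using Finset.sum_mul_sq_le_sq_mul_sq Finset.univ (fun j => ‖U i j‖) (fun j => v j)

/-- if `Q* A Q = D + U` is a Schur decomposition of `A` (`Q` unitary,
`D` diagonal, `U` strictly upper triangular) and `f` is analytic on a closed convex
set `Ω` containing `spec(A)`, then, with `f(A) = p(A)` for the Hermite interpolating
polynomial `p` of `f` at the roots of the minimal polynomial of `A`,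
`‖f(A)‖ ≤ Σ_{i=0}^{N−1} sup_{z∈Ω}|f^{(i)}(z)| ‖U‖_F^i / i!`
(stated via arbitrary upper bounds `M i` of `|f^{(i)}|` on `Ω`). -/
theorem opNorm_matrixFunction_le {N : ℕ} (A Q D U fA : Matrix (Fin N) (Fin N) ℂ)
    (f : ℂ → ℂ)
    (hQ : Q ∈ Matrix.unitaryGroup (Fin N) ℂ)
    (hSchur : Qᴴ * A * Q = D + U)
    (hD : D.IsDiag)
    (hUtri : ∀ i j : Fin N, j ≤ i → U i j = 0)
    (Ω V : Set ℂ) (hΩclosed : IsClosed Ω) (hΩconv : Convex ℝ Ω)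
    (hspec : spectrum ℂ A ⊆ Ω)
    (hV : IsOpen V) (hΩV : Ω ⊆ V) (hf : ∀ w ∈ V, AnalyticAt ℂ f w)
    (p : Polynomial ℂ)
    (hinterp : ∀ μ : ℂ, ∀ j < (minpoly ℂ A).rootMultiplicity μ,
      iteratedDeriv j (fun w => p.eval w) μ = iteratedDeriv j f μ)
    (hfA : fA = Polynomial.aeval A p)
    (M : ℕ → ℝ) (hM : ∀ i : ℕ, ∀ w ∈ Ω, ‖iteratedDeriv i f w‖ ≤ M i) :
    opNorm2 fA ≤ ∑ i ∈ Finset.range N, M i * frobNorm U ^ i / (i.factorial : ℝ) := by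
  classical
  set T := D + U with hT
  set lam : Fin N → ℂ := fun i => D i i with hlam_def
  have hDd : D = diagonal lam := by
    ext i j
    rw [diagonal_apply]
    split_ifs with hij
    · rw [hij]
    · exact hD hij
  have hQ1 : Qᴴ * Q = 1 := Matrix.mem_unitaryGroup_iff'.1 hQ
  have hQ2 : Q * Qᴴ = 1 := Matrix.mem_unitaryGroup_iff.1 hQ
  have hA : A = Q * T * Qᴴ := by
    rw [← hSchur]
    calc A = (Q * Qᴴ) * A * (Q * Qᴴ) := by simp [hQ2]
      _ = _ := by simp only [Matrix.mul_assoc]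
  have hcp : A.charpoly = ∏ i, (Polynomial.X - Polynomial.C (lam i)) := by
    have h1 : A.charpoly = T.charpoly := by
      rw [hA, Matrix.charpoly_mul_comm, ← Matrix.mul_assoc, hQ1, Matrix.one_mul]
    have h2 : T.BlockTriangular id := by
      intro i j hij
      have hij' : j < i := hij
      rw [hT, Matrix.add_apply, hUtri i j hij'.le, hD hij'.ne']
      simp
    rw [h1, Matrix.charpoly_of_upperTriangular T h2]
    refine Finset.prod_congr rfl fun i _ => ?_
    rw [hT, Matrix.add_apply, hUtri i i le_rfl, add_zero]
  have hlam : ∀ i, lam i ∈ Ω := by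
    intro i
    apply hspec
    rw [Matrix.mem_spectrum_iff_isRoot_charpoly, hcp, Polynomial.IsRoot, Polynomial.eval_prod]
    exact Finset.prod_eq_zero (Finset.mem_univ i) (by simp)
  have hfd : DifferentiableOn ℂ f V := fun w hw => (hf w hw).differentiableAt.differentiableWithinAt
  obtain ⟨q, h, hh, hq⟩ := aux_interp hV lam (fun i => hΩV (hlam i)) f hfd Finset.univ
  have hmono := A.charpoly_monic
  have hm0 : minpoly ℂ A ≠ 0 := minpoly.ne_zero (Matrix.isIntegral A)
  have hdvd : minpoly ℂ A ∣ p - q := by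
    apply aux_dvd _ _ hm0
    intro μ j hj
    have hroot : (minpoly ℂ A).IsRoot μ :=
      (Polynomial.rootMultiplicity_pos hm0).1 (by omega)
    have hμ : μ ∈ V := by
      apply hΩV
      apply hspec
      rw [Matrix.mem_spectrum_iff_isRoot_charpoly]
      exact hroot.dvd (Matrix.minpoly_dvd_charpoly A)
    have hle := Polynomial.rootMultiplicity_le_rootMultiplicity_of_dvd hmono.ne_zero
      (Matrix.minpoly_dvd_charpoly A) μ
    have hv := aux_vanish hV h hh A.charpoly hmono.ne_zero μ hμ j (by omega)
    have hi := hinterp μ j hj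
    have hqc : ∀ P : Polynomial ℂ, ContDiffAt ℂ j (fun w => P.eval w) μ := fun P =>
      ((P.differentiable.differentiableOn (s := Set.univ)).analyticAt
        Filter.univ_mem).contDiffAt
    have hfun : f = (fun w => q.eval w) + fun z => h z * A.charpoly.eval z := by
      funext z
      rw [Pi.add_apply, hq z, hcp, Polynomial.eval_prod]
      simp
    have hhc : ContDiffAt ℂ j (fun z => h z * A.charpoly.eval z) μ :=
      (hh.analyticAt (hV.mem_nhds hμ)).contDiffAt.mul (hqc _)
    rw [hfun, iteratedDeriv_add (hqc q) hhc, hv, add_zero] at hi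
    have : (fun w => (p - q).eval w) = (fun w => p.eval w) - fun w => q.eval w := by
      funext w; simp
    rw [this, iteratedDeriv_sub (hqc p) (hqc q), hi, sub_self]
  have hpq : Polynomial.aeval A p = Polynomial.aeval A q := by
    have h0 : Polynomial.aeval A (p - q) = 0 := by
      obtain ⟨s, hs⟩ := hdvd
      rw [hs, map_mul, minpoly.aeval, zero_mul]
    rw [map_sub, sub_eq_zero] at h0
    exact h0
  have hconj : Polynomial.aeval A q = Q * Polynomial.aeval T q * Qᴴ := by
    have hpow : ∀ n : ℕ, A ^ n = Q * T ^ n * Qᴴ := by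
      intro n
      induction n with
      | zero => simp [hQ2]
      | succ n ihn =>
        rw [pow_succ, ihn, pow_succ]
        conv_lhs => rw [hA]
        calc Q * T ^ n * Qᴴ * (Q * T * Qᴴ) = Q * T ^ n * (Qᴴ * Q) * T * Qᴴ := by
              simp only [Matrix.mul_assoc]
          _ = _ := by rw [hQ1, Matrix.mul_one, Matrix.mul_assoc Q]
    rw [Polynomial.aeval_eq_sum_range, Polynomial.aeval_eq_sum_range, Matrix.mul_sum,
      Matrix.sum_mul]
    refine Finset.sum_congr rfl fun n _ => ?_
    rw [hpow, Matrix.mul_smul, Matrix.smul_mul]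
  have hnorm : opNorm2 fA ≤ opNorm2 (Polynomial.aeval T q) := by
    have hone : ∀ W : Matrix (Fin N) (Fin N) ℂ, Wᴴ * W = 1 →
        ‖Matrix.toEuclideanCLM (𝕜 := ℂ) W‖ ≤ 1 := by
      intro W hW
      have h1 := CStarRing.norm_star_mul_self (x := Matrix.toEuclideanCLM (𝕜 := ℂ) W)
      rw [← map_star, ← map_mul, Matrix.star_eq_conjTranspose, hW, map_one] at h1
      have h2 : ‖(1 : EuclideanSpace ℂ (Fin N) →L[ℂ] EuclideanSpace ℂ (Fin N))‖ ≤ 1 :=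
        ContinuousLinearMap.norm_id_le
      rw [h1] at h2
      nlinarith [norm_nonneg (Matrix.toEuclideanCLM (𝕜 := ℂ) W)]
    rw [hfA, hpq, hconj]
    unfold opNorm2
    rw [map_mul, map_mul]
    refine (norm_mul_le _ _).trans ?_
    refine (mul_le_of_le_one_right (norm_nonneg _)
      (hone _ (by rw [Matrix.conjTranspose_conjTranspose, hQ2]))).trans ?_
    exact (norm_mul_le _ _).trans (mul_le_of_le_one_left (norm_nonneg _) (hone _ hQ1))
  refine hnorm.trans ?_
  have hent : ∀ i j, ‖(Polynomial.aeval T q) i j‖ ≤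
      (∑ k ∈ Finset.range N, (M k / (k.factorial : ℝ)) • (U.map norm) ^ k) i j := by
    intro i j
    have hrow := aux_row hV hΩV hΩconv lam hlam U hUtri i f M q
      (fun z => h z * ∏ l ∈ Finset.univ \ Finset.Ici i, (z - lam l)) hfd
      (hh.mul (Differentiable.differentiableOn (by fun_prop))) hM
      (by
        intro z _
        rw [mul_assoc, Finset.prod_sdiff (Finset.subset_univ _)]
        exact hq z) j
    rw [← hDd, ← hT] at hrow
    refine hrow.trans ?_
    rw [Matrix.sum_apply]
    simp only [Matrix.smul_apply, smul_eq_mul]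
    refine Finset.sum_le_sum_of_subset_of_nonneg (Finset.range_mono (by omega)) ?_
    intro k _ _
    have h1 : 0 ≤ M k := (norm_nonneg _).trans (hM k _ (hlam i))
    exact mul_nonneg (by positivity) (aux_pow_nonneg U k i j)
  refine (aux_norm_le _ _ hent).trans ?_
  rw [map_sum]
  refine (norm_sum_le _ _).trans (Finset.sum_le_sum fun k hk => ?_)
  have hMk : 0 ≤ M k := by
    have hN : 0 < N := by have := Finset.mem_range.1 hk; omega
    exact (norm_nonneg _).trans (hM k _ (hlam ⟨0, hN⟩))
  rw [map_smul, norm_smul, map_pow, Real.norm_of_nonneg (by positivity), mul_div_right_comm]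
  refine mul_le_mul_of_nonneg_left ?_ (by positivity)
  rcases Nat.eq_zero_or_pos k with rfl | hk0
  · simp only [pow_zero]
    exact ContinuousLinearMap.norm_id_le
  · exact (norm_pow_le' _ hk0).trans (pow_le_pow_left₀ (norm_nonneg _) (aux_frob U) _)
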